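/- arXiv:1205.7058 — 10 statements merged into one kernel-verified Lean document; each statement's English description precedes it below -/
import Mathlib

section
/- Let 0 < p ≤ 1 and let Φ be an increasing homeomorphism of [0,∞) onto itself. Then Φ belongs to the class 𝓛_p (i.e., Φ is of lower type p and t ↦ Φ(t)/t is non-increasing on (0,∞)) if and only if its inverse Φ⁻¹ belongs to the class 𝓤^{1/p} (i.e., Φ⁻¹ is of upper type 1/p and t ↦ Φ⁻¹(t)/t is non-decreasing on (0,∞)). -/
/-- Proposition 2.1 (phiandinverse): for `0 < p ≤ 1` and `Φ` an increasing homeomorphism of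
`[0,∞)` onto itself (with inverse `Φinv`), `Φ ∈ 𝓛_p` iff `Φinv ∈ 𝓤^{1/p}`. -/
theorem stmt_0 (p : ℝ) (hp0 : 0 < p) (hp1 : p ≤ 1)
    (Φ Φinv : ℝ → ℝ)
    (hmono : StrictMonoOn Φ (Set.Ici 0))
    (hcont : ContinuousOn Φ (Set.Ici 0))
    (hzero : Φ 0 = 0)
    (hinv_nonneg : ∀ t, 0 ≤ t → 0 ≤ Φinv t)
    (hleft : ∀ t, 0 ≤ t → Φinv (Φ t) = t)
    (hright : ∀ t, 0 ≤ t → Φ (Φinv t) = t) :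
    ((∃ C > 0, ∀ s > 0, ∀ t : ℝ, 0 < t → t ≤ 1 → Φ (s * t) ≤ C * t ^ p * Φ s) ∧
        (∀ s t : ℝ, 0 < s → s ≤ t → Φ t / t ≤ Φ s / s))
      ↔
    ((∃ C > 0, ∀ s > 0, ∀ t : ℝ, 1 ≤ t → Φinv (s * t) ≤ C * t ^ (1 / p) * Φinv s) ∧
        (∀ s t : ℝ, 0 < s → s ≤ t → Φinv s / s ≤ Φinv t / t)) := by
  have hpos : ∀ t, 0 < t → 0 < Φ t := fun t ht => by
    simpa [hzero] using hmono (Set.mem_Ici.2 le_rfl) (Set.mem_Ici.2 ht.le) ht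
  have hinv_pos : ∀ t, 0 < t → 0 < Φinv t := fun t ht => by
    refine (hinv_nonneg t ht.le).lt_of_ne fun h => ht.ne' ?_
    rw [← hright t ht.le, ← h, hzero]
  have hle : ∀ s t, 0 < s → s ≤ t → Φ s ≤ Φ t := fun s t hs hst =>
    hmono.monotoneOn hs.le (hs.le.trans hst) hst
  have hinv_le : ∀ s t, 0 < s → s ≤ t → Φinv s ≤ Φinv t := fun s t hs hst => by
    have ht := hs.trans_le hst
    rwa [← hmono.le_iff_le (hinv_nonneg s hs.le) (hinv_nonneg t ht.le), hright s hs.le,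
      hright t ht.le]
  constructor
  · rintro ⟨⟨C, hC, hlower⟩, hanti⟩
    refine ⟨⟨C ^ (1 / p), by positivity, fun s hs t ht => ?_⟩, fun s t hs hst => ?_⟩
    · have ht0 : 0 < t := one_pos.trans_le ht
      have hst : 0 < s * t := mul_pos hs ht0
      have ha := hinv_pos s hs
      have hb := hinv_pos (s * t) hst
      have hab := hinv_le s (s * t) hs (le_mul_of_one_le_right hs.le ht)
      have h := hlower _ hb (Φinv s / Φinv (s * t)) (div_pos ha hb) ((div_le_one hb).2 hab)
      rw [mul_div_cancel₀ _ hb.ne', hright s hs.le, hright _ hst.le,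
        Real.div_rpow ha.le hb.le] at h
      have hbp := Real.rpow_pos_of_pos hb p
      have key : Φinv (s * t) ^ p ≤ C * t * Φinv s ^ p := by
        refine le_of_mul_le_mul_left ?_ hs
        calc s * Φinv (s * t) ^ p
            ≤ C * (Φinv s ^ p / Φinv (s * t) ^ p) * (s * t) * Φinv (s * t) ^ p := by gcongr
          _ = s * (C * t * Φinv s ^ p) := by field_simp
      refine (Real.rpow_le_rpow_iff hb.le (by positivity) hp0).1 (key.trans_eq ?_)
      rw [Real.mul_rpow (by positivity) ha.le, Real.mul_rpow (by positivity) (by positivity),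
        ← Real.rpow_mul hC.le, ← Real.rpow_mul ht0.le, one_div_mul_cancel hp0.ne',
        Real.rpow_one, Real.rpow_one]
    · have ht := hs.trans_le hst
      have h := hanti _ _ (hinv_pos s hs) (hinv_le s t hs hst)
      rw [hright s hs.le, hright t ht.le] at h
      simpa [inv_div] using inv_anti₀ (div_pos ht (hinv_pos t ht)) h
  · rintro ⟨⟨C, hC, hupper⟩, hinc⟩
    refine ⟨⟨C ^ p, by positivity, fun s hs t ht0 ht => ?_⟩, fun s t hs hst => ?_⟩
    · have hst : 0 < s * t := mul_pos hs ht0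
      have ha := hpos (s * t) hst
      have hb := hpos s hs
      have hab := hle (s * t) s hst (mul_le_of_le_one_right hs.le ht)
      have h := hupper _ ha (Φ s / Φ (s * t)) ((one_le_div ha).2 hab)
      rw [mul_div_cancel₀ _ ha.ne', hleft s hs.le, hleft _ hst.le] at h
      have key : 1 ≤ C * (Φ s / Φ (s * t)) ^ (1 / p) * t :=
        le_of_mul_le_mul_left (by linarith) hs
      have hpow := Real.one_le_rpow key hp0.le
      rw [Real.mul_rpow (by positivity) ht0.le, Real.mul_rpow hC.le (by positivity),
        ← Real.rpow_mul (by positivity), one_div_mul_cancel hp0.ne', Real.rpow_one] at hpow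
      calc Φ (s * t) ≤ C ^ p * (Φ s / Φ (s * t)) * t ^ p * Φ (s * t) :=
            le_mul_of_one_le_left ha.le hpow
        _ = C ^ p * t ^ p * Φ s := by field_simp
    · have ht := hs.trans_le hst
      have h := hinc _ _ (hpos s hs) (hle s t hs hst)
      rw [hleft s hs.le, hleft t ht.le] at h
      simpa [inv_div] using inv_anti₀ (div_pos hs (hpos s hs)) h
end

section
/- Let 0 < p ≤ 1, let Φ₁ be an increasing homeomorphism of [0,∞) belonging to the class 𝓛_p, and let Ψ₂ be an increasing homeomorphism of [0,∞) such that t ↦ Ψ₂⁻¹(t)/t is non-increasing on (0,∞). Define Φ as the increasing homeomorphism of [0,∞) whose inverse is Φ⁻¹(t) = Φ₁⁻¹(t)·Ψ₂⁻¹(t). Then Φ⁻¹ is of upper type (p+1)/p and t ↦ Φ⁻¹(t)/t is non-decreasing on (0,∞); consequently Φ belongs to the class 𝓛_{p/(p+1)}. -/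
theorem le_rpow_inv_mul_of_one_le {r C t x y : ℝ} (hr : 0 < r) (hC : 0 < C) (ht : 0 < t)
    (hx : 0 < x) (hy : 0 < y) (h : 1 ≤ C * (x / y) ^ r * t) :
    y ≤ C ^ r⁻¹ * t ^ r⁻¹ * x := by
  have hpow : (y / x) ^ r ≤ C * t := by
    have hinv : (y / x) ^ r * (x / y) ^ r = 1 := by
      rw [← Real.mul_rpow (by positivity) (by positivity)]
      have : y / x * (x / y) = 1 := by field_simp
      rw [this, Real.one_rpow]
    have hpos : 0 < (y / x) ^ r := by positivity
    calc (y / x) ^ r = (y / x) ^ r * 1 := by ring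
      _ ≤ (y / x) ^ r * (C * (x / y) ^ r * t) := by gcongr
      _ = ((y / x) ^ r * (x / y) ^ r) * (C * t) := by ring
      _ = C * t := by rw [hinv, one_mul]
  rw [← Real.mul_rpow hC.le ht.le, ← div_le_iff₀ hx]
  exact (Real.le_rpow_inv_iff_of_pos (by positivity) (by positivity) hr).2 hpow

theorem StrictMonoOn.monotoneOn_rightInv {f g : ℝ → ℝ} (hf : StrictMonoOn f (Set.Ici 0))
    (hg : ∀ t, 0 ≤ t → 0 ≤ g t) (hfg : ∀ t, 0 ≤ t → f (g t) = t) :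
    MonotoneOn g (Set.Ici 0) := by
  intro a ha b hb hab
  rw [← hf.le_iff_le (hg a ha) (hg b hb), hfg a ha, hfg b hb]
  exact hab

theorem rightInv_pos {f g : ℝ → ℝ} (hf0 : f 0 = 0)
    (hg : ∀ t, 0 ≤ t → 0 ≤ g t) (hfg : ∀ t, 0 ≤ t → f (g t) = t) {t : ℝ} (ht : 0 < t) :
    0 < g t := by
  refine (hg t ht.le).lt_of_ne fun h => ht.ne ?_
  rw [← hfg t ht.le, ← h, hf0]

/-- Lemma 2.2 (stability): if `Φ₁ ∈ 𝓛_p` and `Ψ₂` is an increasing homeomorphism of `[0,∞)`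
with `t ↦ Ψ₂⁻¹(t)/t` non-increasing, and `Φ` is the increasing homeomorphism with
`Φ⁻¹ = Φ₁⁻¹ · Ψ₂⁻¹`, then `Φ⁻¹` is of upper type `(p+1)/p`, `t ↦ Φ⁻¹(t)/t` is non-decreasing,
and `Φ ∈ 𝓛_{p/(p+1)}`. -/
theorem stmt_1 (p : ℝ) (hp0 : 0 < p) (hp1 : p ≤ 1)
    (Φ₁ Φ₁inv : ℝ → ℝ)
    (h₁mono : StrictMonoOn Φ₁ (Set.Ici 0))
    (h₁cont : ContinuousOn Φ₁ (Set.Ici 0))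
    (h₁zero : Φ₁ 0 = 0)
    (h₁inv_nonneg : ∀ t, 0 ≤ t → 0 ≤ Φ₁inv t)
    (h₁left : ∀ t, 0 ≤ t → Φ₁inv (Φ₁ t) = t)
    (h₁right : ∀ t, 0 ≤ t → Φ₁ (Φ₁inv t) = t)
    -- `Φ₁ ∈ 𝓛_p` :
    (h₁low : ∃ C > 0, ∀ s > 0, ∀ t : ℝ, 0 < t → t ≤ 1 → Φ₁ (s * t) ≤ C * t ^ p * Φ₁ s)
    (h₁ratio : ∀ s t : ℝ, 0 < s → s ≤ t → Φ₁ t / t ≤ Φ₁ s / s)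
    (Ψ₂ Ψ₂inv : ℝ → ℝ)
    (h₂mono : StrictMonoOn Ψ₂ (Set.Ici 0))
    (h₂cont : ContinuousOn Ψ₂ (Set.Ici 0))
    (h₂zero : Ψ₂ 0 = 0)
    (h₂inv_nonneg : ∀ t, 0 ≤ t → 0 ≤ Ψ₂inv t)
    (h₂left : ∀ t, 0 ≤ t → Ψ₂inv (Ψ₂ t) = t)
    (h₂right : ∀ t, 0 ≤ t → Ψ₂ (Ψ₂inv t) = t)
    -- `t ↦ Ψ₂⁻¹(t)/t` is non-increasing :
    (h₂ratio : ∀ s t : ℝ, 0 < s → s ≤ t → Ψ₂inv t / t ≤ Ψ₂inv s / s)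
    (Φ Φinv : ℝ → ℝ)
    (hmono : StrictMonoOn Φ (Set.Ici 0))
    (hcont : ContinuousOn Φ (Set.Ici 0))
    (hzero : Φ 0 = 0)
    (hinv_nonneg : ∀ t, 0 ≤ t → 0 ≤ Φinv t)
    (hleft : ∀ t, 0 ≤ t → Φinv (Φ t) = t)
    (hright : ∀ t, 0 ≤ t → Φ (Φinv t) = t)
    -- `Φ⁻¹ = Φ₁⁻¹ · Ψ₂⁻¹` :
    (hdef : ∀ t, 0 ≤ t → Φinv t = Φ₁inv t * Ψ₂inv t) :
    -- `Φ⁻¹` is of upper type `(p+1)/p` :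
    (∃ C > 0, ∀ s > 0, ∀ t : ℝ, 1 ≤ t → Φinv (s * t) ≤ C * t ^ ((p + 1) / p) * Φinv s) ∧
    -- `t ↦ Φ⁻¹(t)/t` is non-decreasing :
    (∀ s t : ℝ, 0 < s → s ≤ t → Φinv s / s ≤ Φinv t / t) ∧
    -- consequently `Φ ∈ 𝓛_{p/(p+1)}` :
    (∃ C > 0, ∀ s > 0, ∀ t : ℝ, 0 < t → t ≤ 1 → Φ (s * t) ≤ C * t ^ (p / (p + 1)) * Φ s) ∧
    (∀ s t : ℝ, 0 < s → s ≤ t → Φ t / t ≤ Φ s / s) := by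
  have g₁mono := h₁mono.monotoneOn_rightInv h₁inv_nonneg h₁right
  have g₂mono := h₂mono.monotoneOn_rightInv h₂inv_nonneg h₂right
  have g₁pos {t : ℝ} (ht : 0 < t) : 0 < Φ₁inv t := rightInv_pos h₁zero h₁inv_nonneg h₁right ht
  have gpos {t : ℝ} (ht : 0 < t) : 0 < Φinv t := rightInv_pos hzero hinv_nonneg hright ht
  have fpos {t : ℝ} (ht : 0 < t) : 0 < Φ t := by
    rw [← hzero]
    exact hmono Set.self_mem_Ici ht.le ht
  have hupper : ∃ C > 0, ∀ s > 0, ∀ t : ℝ, 1 ≤ t →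
      Φinv (s * t) ≤ C * t ^ ((p + 1) / p) * Φinv s := by
    obtain ⟨C, hC, hlow⟩ := h₁low
    refine ⟨C ^ p⁻¹, by positivity, fun s hs t ht => ?_⟩
    have ht0 : 0 < t := by linarith
    have hst : 0 < s * t := by positivity
    have hsst : s ≤ s * t := le_mul_of_one_le_right hs.le ht
    have hu := g₁pos hs
    have hv := g₁pos hst
    have huv : Φ₁inv s ≤ Φ₁inv (s * t) := g₁mono hs.le hst.le hsst
    have h₁ : Φ₁inv (s * t) ≤ C ^ p⁻¹ * t ^ p⁻¹ * Φ₁inv s := by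
      refine le_rpow_inv_mul_of_one_le hp0 hC ht0 hu hv ?_
      have h := hlow _ hv (Φ₁inv s / Φ₁inv (s * t)) (by positivity) ((div_le_one hv).2 huv)
      rw [mul_div_cancel₀ _ hv.ne', h₁right s hs.le, h₁right _ hst.le] at h
      refine le_of_mul_le_mul_right ?_ hs
      linarith
    have h₂ : Ψ₂inv (s * t) ≤ t * Ψ₂inv s := by
      have h := h₂ratio s (s * t) hs hsst
      rw [div_le_div_iff₀ hst hs] at h
      refine le_of_mul_le_mul_right ?_ hs
      linarith
    have hexp : t ^ ((p + 1) / p) = t ^ p⁻¹ * t := by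
      rw [show (p + 1) / p = p⁻¹ + 1 by field_simp; ring, Real.rpow_add_one ht0.ne']
    rw [hdef _ hst.le, hdef s hs.le, hexp]
    calc Φ₁inv (s * t) * Ψ₂inv (s * t)
        ≤ (C ^ p⁻¹ * t ^ p⁻¹ * Φ₁inv s) * (t * Ψ₂inv s) :=
          mul_le_mul h₁ h₂ (h₂inv_nonneg _ hst.le) (by positivity)
      _ = _ := by ring
  have hratio : ∀ s t : ℝ, 0 < s → s ≤ t → Φinv s / s ≤ Φinv t / t := by
    intro s t hs hst
    have ht : 0 < t := hs.trans_le hst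
    have hu := g₁pos hs
    have hv := g₁pos ht
    have h₁ : Φ₁inv s / s ≤ Φ₁inv t / t := by
      have h := h₁ratio _ _ hu (g₁mono hs.le ht.le hst)
      rw [h₁right s hs.le, h₁right t ht.le, div_le_div_iff₀ hv hu] at h
      rw [div_le_div_iff₀ hs ht]
      linarith
    rw [hdef s hs.le, hdef t ht.le, mul_div_right_comm, mul_div_right_comm]
    exact mul_le_mul h₁ (g₂mono hs.le ht.le hst) (h₂inv_nonneg s hs.le) (by positivity)
  refine ⟨hupper, hratio, ?_, fun s t hs hst => ?_⟩
  · obtain ⟨C, hC, hup⟩ := hupper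
    refine ⟨C ^ ((p + 1) / p)⁻¹, by positivity, fun s hs t ht0 ht1 => ?_⟩
    have hst : 0 < s * t := by positivity
    have hx := fpos hs
    have hy := fpos hst
    have hyx : Φ (s * t) ≤ Φ s :=
      hmono.monotoneOn hst.le hs.le (mul_le_of_le_one_right hs.le ht1)
    rw [← inv_div (p + 1) p]
    refine le_rpow_inv_mul_of_one_le (by positivity) hC ht0 hx hy ?_
    have h := hup _ hy (Φ s / Φ (s * t)) ((one_le_div hy).2 hyx)
    rw [mul_div_cancel₀ _ hy.ne', hleft s hs.le, hleft _ hst.le] at h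
    refine le_of_mul_le_mul_right ?_ hs
    linarith
  · have ht : 0 < t := hs.trans_le hst
    have h := hratio _ _ (fpos hs) (hmono.monotoneOn hs.le ht.le hst)
    rw [hleft s hs.le, hleft t ht.le, div_le_div_iff₀ (fpos hs) (fpos ht)] at h
    rw [div_le_div_iff₀ ht hs]
    linarith
end

section
/- Let q ≥ 1 and let Φ₁, Φ₂ be increasing homeomorphisms of [0,∞) belonging to the class 𝓤^q, with the complementary function Ψ₂ of Φ₂ also an increasing homeomorphism of [0,∞). Suppose that t ↦ Φ₂⁻¹(Φ₁(t))/t is non-increasing on (0,∞). Then the function φ⁻¹(t) := t·Φ₁⁻¹(t)/Φ₂⁻¹(t) is of upper type 2, and t ↦ φ⁻¹(t)/t is non-decreasing on (0,∞); consequently the inverse function φ belongs to the class 𝓛_{1/2}. -/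
section RightInverse

variable {f g : ℝ → ℝ}

theorem rightInverse_pos (hf : f 0 = 0) (hg : ∀ t, 0 ≤ t → 0 ≤ g t)
    (hfg : ∀ t, 0 ≤ t → f (g t) = t) {t : ℝ} (ht : 0 < t) : 0 < g t := by
  refine (hg t ht.le).lt_of_ne fun h => ht.ne ?_
  rw [← hfg t ht.le, ← h, hf]

theorem rightInverse_mono (hf : StrictMonoOn f (Set.Ici 0)) (hg : ∀ t, 0 ≤ t → 0 ≤ g t)
    (hfg : ∀ t, 0 ≤ t → f (g t) = t) {s t : ℝ} (hs : 0 ≤ s) (hst : s ≤ t) : g s ≤ g t := by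
  have ht := hs.trans hst
  rwa [← hf.le_iff_le (hg s hs) (hg t ht), hfg s hs, hfg t ht]

/-- If `f t / t` is non-decreasing then its right inverse is of upper type `1`
with constant `1`. -/
theorem rightInverse_mul_le (hf : StrictMonoOn f (Set.Ici 0)) (hf0 : f 0 = 0)
    (hg : ∀ t, 0 ≤ t → 0 ≤ g t) (hfg : ∀ t, 0 ≤ t → f (g t) = t)
    (hratio : ∀ s t : ℝ, 0 < s → s ≤ t → f s / s ≤ f t / t)
    {s t : ℝ} (hs : 0 < s) (ht : 1 ≤ t) : g (s * t) ≤ t * g s := by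
  have hst : 0 < s * t := by positivity
  have hu := rightInverse_pos hf0 hg hfg hs
  have hv := rightInverse_pos hf0 hg hfg hst
  have h := hratio _ _ hu (rightInverse_mono hf hg hfg hs.le (le_mul_of_one_le_right hs.le ht))
  rw [hfg s hs.le, hfg _ hst.le, div_le_div_iff₀ hu hv] at h
  exact le_of_mul_le_mul_left (by linarith) hs

end RightInverse

/-- If `ψ` is of upper type `2` with constant `1` and `ψ t / t` is non-decreasing, then a
right inverse of `ψ` is of lower type `1 / 2` with constant `1`, and its ratio to the identity is
non-increasing. -/
theorem rightInverse_lowerType_half {ψ φ : ℝ → ℝ} (hψ0 : ψ 0 = 0) (hψpos : ∀ t, 0 < t → 0 < ψ t)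
    (hup : ∀ s > 0, ∀ t : ℝ, 1 ≤ t → ψ (s * t) ≤ t ^ 2 * ψ s)
    (hratio : ∀ s t : ℝ, 0 < s → s ≤ t → ψ s / s ≤ ψ t / t)
    (hφ : ∀ t, 0 ≤ t → 0 ≤ φ t) (hψφ : ∀ t, 0 ≤ t → ψ (φ t) = t) :
    (∀ s > 0, ∀ t : ℝ, 0 < t → t ≤ 1 → φ (s * t) ≤ t ^ ((1 : ℝ) / 2) * φ s) ∧
      (∀ s t : ℝ, 0 < s → s ≤ t → φ t / t ≤ φ s / s) := by
  have hψmono : StrictMonoOn ψ (Set.Ici 0) := by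
    intro x (hx : 0 ≤ x) y (hy : 0 ≤ y) hxy
    rcases hx.eq_or_lt with rfl | hx
    · simpa [hψ0] using hψpos y hxy
    have hy := hx.trans hxy
    have h := hratio x y hx hxy.le
    rw [div_le_div_iff₀ hx hy] at h
    have := mul_lt_mul_of_pos_left hxy (hψpos x hx)
    exact lt_of_mul_lt_mul_right (this.trans_le h) hx.le
  have hφpos {t : ℝ} (ht : 0 < t) : 0 < φ t := rightInverse_pos hψ0 hφ hψφ ht
  constructor
  · intro s hs t ht ht1
    have hst : 0 < s * t := by positivity
    have hx := hφpos hs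
    have hy := hφpos hst
    have hyx := rightInverse_mono hψmono hφ hψφ hst.le (mul_le_of_le_one_right hs.le ht1)
    have h := hup _ hy (φ s / φ (s * t)) ((one_le_div hy).2 hyx)
    rw [mul_div_cancel₀ _ hy.ne', hψφ s hs.le, hψφ _ hst.le, div_pow, div_mul_eq_mul_div,
      le_div_iff₀ (by positivity)] at h
    have h' : φ (s * t) ^ 2 ≤ t * φ s ^ 2 := le_of_mul_le_mul_left (by linarith) hs
    rw [← Real.sqrt_eq_rpow]
    refine (sq_le_sq₀ hy.le (by positivity)).1 ?_
    rwa [mul_pow, Real.sq_sqrt ht.le]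
  · intro s t hs hst
    have ht := hs.trans_le hst
    have h := hratio _ _ (hφpos hs) (rightInverse_mono hψmono hφ hψφ hs.le hst)
    rw [hψφ s hs.le, hψφ t ht.le, div_le_div_iff₀ (hφpos hs) (hφpos ht)] at h
    rw [div_le_div_iff₀ ht hs]
    linarith


/-- Lemma 2.6 (conditionforlowertype): let `Φ₁, Φ₂ ∈ 𝓤^q` with complementary function `Ψ₂` of
`Φ₂` an increasing homeomorphism of `[0,∞)`, and suppose `t ↦ Φ₂⁻¹(Φ₁(t))/t` is non-increasing.
Then `φ⁻¹(t) = t·Φ₁⁻¹(t)/Φ₂⁻¹(t)` is of upper type `2` with `t ↦ φ⁻¹(t)/t` non-decreasing;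
consequently the inverse function `φ` belongs to `𝓛_{1/2}`. -/
theorem stmt_6 (q : ℝ) (hq : 1 ≤ q)
    (Φ₁ Φ₁inv : ℝ → ℝ)
    (h₁mono : StrictMonoOn Φ₁ (Set.Ici 0))
    (h₁cont : ContinuousOn Φ₁ (Set.Ici 0))
    (h₁zero : Φ₁ 0 = 0)
    (h₁inv_nonneg : ∀ t, 0 ≤ t → 0 ≤ Φ₁inv t)
    (h₁left : ∀ t, 0 ≤ t → Φ₁inv (Φ₁ t) = t)
    (h₁right : ∀ t, 0 ≤ t → Φ₁ (Φ₁inv t) = t)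
    -- `Φ₁ ∈ 𝓤^q` :
    (h₁up : ∃ C > 0, ∀ s > 0, ∀ t : ℝ, 1 ≤ t → Φ₁ (s * t) ≤ C * t ^ q * Φ₁ s)
    (h₁ratio : ∀ s t : ℝ, 0 < s → s ≤ t → Φ₁ s / s ≤ Φ₁ t / t)
    (Φ₂ Φ₂inv : ℝ → ℝ)
    (h₂mono : StrictMonoOn Φ₂ (Set.Ici 0))
    (h₂cont : ContinuousOn Φ₂ (Set.Ici 0))
    (h₂zero : Φ₂ 0 = 0)
    (h₂inv_nonneg : ∀ t, 0 ≤ t → 0 ≤ Φ₂inv t)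
    (h₂left : ∀ t, 0 ≤ t → Φ₂inv (Φ₂ t) = t)
    (h₂right : ∀ t, 0 ≤ t → Φ₂ (Φ₂inv t) = t)
    -- `Φ₂ ∈ 𝓤^q` :
    (h₂up : ∃ C > 0, ∀ s > 0, ∀ t : ℝ, 1 ≤ t → Φ₂ (s * t) ≤ C * t ^ q * Φ₂ s)
    (h₂ratio : ∀ s t : ℝ, 0 < s → s ≤ t → Φ₂ s / s ≤ Φ₂ t / t)
    -- the complementary function `Ψ₂` of `Φ₂` is an increasing homeomorphism of `[0,∞)` :
    (Ψ₂ : ℝ → ℝ)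
    (hΨ₂ : ∀ s, Ψ₂ s = sSup ((fun t => t * s - Φ₂ t) '' Set.Ici 0))
    (hΨ₂mono : StrictMonoOn Ψ₂ (Set.Ici 0))
    (hΨ₂cont : ContinuousOn Ψ₂ (Set.Ici 0))
    (hΨ₂zero : Ψ₂ 0 = 0)
    (hΨ₂surj : Set.SurjOn Ψ₂ (Set.Ici 0) (Set.Ici 0))
    -- `t ↦ Φ₂⁻¹(Φ₁(t))/t` is non-increasing :
    (hcomp : ∀ s t : ℝ, 0 < s → s ≤ t → Φ₂inv (Φ₁ t) / t ≤ Φ₂inv (Φ₁ s) / s) :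
    -- `φ⁻¹(t) = t·Φ₁⁻¹(t)/Φ₂⁻¹(t)` is of upper type `2` :
    (∃ C > 0, ∀ s > 0, ∀ t : ℝ, 1 ≤ t →
      (s * t) * Φ₁inv (s * t) / Φ₂inv (s * t) ≤ C * t ^ (2 : ℝ) * (s * Φ₁inv s / Φ₂inv s)) ∧
    -- `t ↦ φ⁻¹(t)/t` is non-decreasing :
    (∀ s t : ℝ, 0 < s → s ≤ t →
      (s * Φ₁inv s / Φ₂inv s) / s ≤ (t * Φ₁inv t / Φ₂inv t) / t) ∧
    -- consequently the inverse function `φ` of `φ⁻¹` belongs to `𝓛_{1/2}` :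
    (∀ φ : ℝ → ℝ, (∀ t, 0 ≤ t → 0 ≤ φ t) →
      (∀ t, 0 ≤ t → φ (t * Φ₁inv t / Φ₂inv t) = t) →
      (∀ t, 0 ≤ t → (φ t) * Φ₁inv (φ t) / Φ₂inv (φ t) = t) →
      (∃ C > 0, ∀ s > 0, ∀ t : ℝ, 0 < t → t ≤ 1 → φ (s * t) ≤ C * t ^ ((1 : ℝ) / 2) * φ s) ∧
      (∀ s t : ℝ, 0 < s → s ≤ t → φ t / t ≤ φ s / s)) := by
  have ha {t : ℝ} (ht : 0 < t) : 0 < Φ₁inv t := rightInverse_pos h₁zero h₁inv_nonneg h₁right ht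
  have hb {t : ℝ} (ht : 0 < t) : 0 < Φ₂inv t := rightInverse_pos h₂zero h₂inv_nonneg h₂right ht
  have hup : ∀ s > 0, ∀ t : ℝ, 1 ≤ t →
      (s * t) * Φ₁inv (s * t) / Φ₂inv (s * t) ≤ t ^ 2 * (s * Φ₁inv s / Φ₂inv s) := by
    intro s hs t ht
    have hat := rightInverse_mul_le h₁mono h₁zero h₁inv_nonneg h₁right h₁ratio hs ht
    have hbt := rightInverse_mono h₂mono h₂inv_nonneg h₂right hs.le
      (le_mul_of_one_le_right hs.le ht)
    have has := ha hs
    have hbs := hb hs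
    calc (s * t) * Φ₁inv (s * t) / Φ₂inv (s * t) ≤ (s * t) * (t * Φ₁inv s) / Φ₂inv s := by gcongr
      _ = t ^ 2 * (s * Φ₁inv s / Φ₂inv s) := by ring
  have hratio : ∀ s t : ℝ, 0 < s → s ≤ t →
      (s * Φ₁inv s / Φ₂inv s) / s ≤ (t * Φ₁inv t / Φ₂inv t) / t := by
    intro s t hs hst
    have ht := hs.trans_le hst
    have h := hcomp _ _ (ha hs) (rightInverse_mono h₁mono h₁inv_nonneg h₁right hs.le hst)
    rw [h₁right s hs.le, h₁right t ht.le, div_le_div_iff₀ (ha ht) (ha hs)] at h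
    rw [mul_div_assoc, mul_div_cancel_left₀ _ hs.ne', mul_div_assoc,
      mul_div_cancel_left₀ _ ht.ne', div_le_div_iff₀ (hb hs) (hb ht)]
    linarith
  refine ⟨⟨1, one_pos, ?_⟩, hratio, fun φ hφ _ hψφ => ?_⟩
  · simpa only [one_mul, Real.rpow_two] using hup
  · obtain ⟨hlow, hanti⟩ := rightInverse_lowerType_half
      (ψ := fun t => t * Φ₁inv t / Φ₂inv t) (by simp)
      (fun t ht => div_pos (mul_pos ht (ha ht)) (hb ht)) hup hratio hφ hψφ
    exact ⟨⟨1, one_pos, by simpa only [one_mul] using hlow⟩, hanti⟩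
end

section
/- Let (Ω, μ) be a probability space, Φ a convex increasing homeomorphism of [0,∞) onto itself, and 0 < p < ∞. Then for every essentially bounded measurable function g on Ω with 0 < ‖g‖_∞ and 0 < ‖g‖_{L^p(μ)} < ∞, the Luxemburg quasi-norm of g with respect to Φ^p satisfies inf{λ > 0 : ∫_Ω Φ(|g|/λ)^p dμ ≤ 1} ≤ ‖g‖_∞ / Φ⁻¹(‖g‖_∞ / ‖g‖_{L^p(μ)}). -/
open MeasureTheory

/-- Lemma 2.8 (Orlicz norm of a bounded function): on a probability space, for `Φ` a convex
increasing homeomorphism of `[0,∞)`, `0 < p < ∞`, and `g` essentially bounded,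
`‖g‖^{lux}_{L^{Φ^p}} ≤ ‖g‖_∞ / Φ⁻¹(‖g‖_∞/‖g‖_{L^p})`. -/
theorem stmt_7 {Ω : Type*} [MeasurableSpace Ω] (μ : Measure Ω) [IsProbabilityMeasure μ]
    (Φ Φinv : ℝ → ℝ)
    (hmono : StrictMonoOn Φ (Set.Ici 0))
    (hcont : ContinuousOn Φ (Set.Ici 0))
    (hzero : Φ 0 = 0)
    (hconv : ConvexOn ℝ (Set.Ici 0) Φ)
    (hinv_nonneg : ∀ t, 0 ≤ t → 0 ≤ Φinv t)
    (hleft : ∀ t, 0 ≤ t → Φinv (Φ t) = t)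
    (hright : ∀ t, 0 ≤ t → Φ (Φinv t) = t)
    (p : ℝ) (hp : 0 < p)
    (g : Ω → ℝ) (hgmeas : Measurable g)
    (hgbdd : ∃ Cb : ℝ, ∀ᵐ ω ∂μ, |g ω| ≤ Cb)
    (hM : 0 < essSup (fun ω => |g ω|) μ)
    (hNp : 0 < (∫ ω, |g ω| ^ p ∂μ) ^ (1 / p)) :
    sInf {l : ℝ | 0 < l ∧ ∫⁻ ω, ENNReal.ofReal ((Φ (|g ω| / l)) ^ p) ∂μ ≤ 1}
      ≤ essSup (fun ω => |g ω|) μ /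
          Φinv (essSup (fun ω => |g ω|) μ / (∫ ω, |g ω| ^ p ∂μ) ^ (1 / p)) := by
  set M := essSup (fun ω => |g ω|) μ with hMdef
  set I := ∫ ω, |g ω| ^ p ∂μ with hIdef
  set N := I ^ (1 / p) with hNdef
  have hgM : ∀ᵐ ω ∂μ, |g ω| ≤ M := by
    obtain ⟨C, hC⟩ := hgbdd
    exact ae_le_essSup ⟨C, hC⟩
  have hI_nonneg : 0 ≤ I := integral_nonneg fun ω => Real.rpow_nonneg (abs_nonneg _) _
  have hI : I ≠ 0 := by
    intro h
    rw [hNdef, h, Real.zero_rpow (one_div_pos.2 hp).ne'] at hNp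
    exact hNp.false
  have hint : Integrable (fun ω => |g ω| ^ p) μ := by
    by_contra h
    exact hI (integral_undef h)
  have hNI : N ^ p = I := by
    rw [hNdef, ← Real.rpow_mul hI_nonneg, one_div_mul_cancel hp.ne', Real.rpow_one]
  have hMN : 0 < M / N := div_pos hM hNp
  set s := Φinv (M / N) with hsdef
  have hΦs : Φ s = M / N := hright _ hMN.le
  have hs : 0 < s := by
    refine (hinv_nonneg _ hMN.le).lt_of_ne fun h => ?_
    rw [← hsdef] at h
    rw [← h, hzero] at hΦs
    exact hMN.ne hΦs
  refine csInf_le ⟨0, fun l hl => hl.1.le⟩ ⟨div_pos hM hs, ?_⟩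
  have hbound : ∀ᵐ ω ∂μ, ENNReal.ofReal (Φ (|g ω| / (M / s)) ^ p)
      ≤ ENNReal.ofReal (|g ω| ^ p / I) := by
    filter_upwards [hgM] with ω hω
    have hle : |g ω| / M ≤ 1 := (div_le_one hM).2 hω
    have harg : |g ω| / (M / s) = (1 - |g ω| / M) * 0 + |g ω| / M * s := by
      field_simp
      ring
    have hΦ : Φ (|g ω| / (M / s)) ≤ |g ω| / N := by
      have h := hconv.2 (Set.self_mem_Ici : (0 : ℝ) ∈ Set.Ici 0) (Set.mem_Ici.2 hs.le)
        (sub_nonneg.2 hle) (by positivity : 0 ≤ |g ω| / M) (sub_add_cancel 1 _)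
      simp only [smul_eq_mul] at h
      rw [← harg, hzero, hΦs] at h
      refine h.trans_eq ?_
      field_simp
      ring
    have hΦ_nonneg : 0 ≤ Φ (|g ω| / (M / s)) := by
      have h : 0 ≤ |g ω| / (M / s) := by positivity
      exact hzero.symm.trans_le (hmono.monotoneOn Set.self_mem_Ici h h)
    rw [← hNI, ← Real.div_rpow (abs_nonneg _) hNp.le]
    exact ENNReal.ofReal_le_ofReal (Real.rpow_le_rpow hΦ_nonneg hΦ hp.le)
  refine (lintegral_mono_ae hbound).trans ?_
  rw [← ofReal_integral_eq_lintegral_ofReal (hint.div_const I)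
    (ae_of_all _ fun ω => div_nonneg (Real.rpow_nonneg (abs_nonneg _) _) hI_nonneg),
    integral_div, ← hIdef, div_self hI, ENNReal.ofReal_one]
end

section
/- Let (Ω, μ) be a finite measure space, and let Φ : [0,∞) → [0,∞) be a non-decreasing continuously differentiable function with Φ(0) = 0 such that there is c > 0 with Φ′(λ) ≤ c·Φ(λ)/λ for all λ > 0, and such that I := ∫_1^∞ Φ(t)/t² dt < ∞. Let g : Ω → [0,∞) be measurable and suppose there is A > 0 with λ·μ({ω : g(ω) > λ}) ≤ A for every λ > 0. Then ∫_Ω Φ(g) dμ ≤ μ(Ω)·Φ(1) + c·A·I. -/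
open MeasureTheory

/-- The derivative of a function that is monotone on `[0, ∞)` is nonnegative on `(0, ∞)`. -/
lemma HasDerivAt.nonneg_of_monotoneOn_Ici {f : ℝ → ℝ} {f' x : ℝ} (hf : HasDerivAt f f' x)
    (hmono : MonotoneOn f (Set.Ici 0)) (hx : 0 < x) : 0 ≤ f' := by
  rw [← hf.hasDerivWithinAt.derivWithin (uniqueDiffOn_Ici 0 x hx.le)]
  exact hmono.derivWithin_nonneg

/-- The layer-cake formula for the part of `g` above the level `1`. -/
lemma lintegral_integral_max_sub_one_eq {Ω : Type*} [MeasurableSpace Ω] (μ : Measure Ω)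
    {φ : ℝ → ℝ} (hφ : ContinuousOn φ (Set.Ioi 0)) (hφ0 : ∀ t, 0 < t → 0 ≤ φ t)
    {g : Ω → ℝ} (hg : Measurable g) :
    ∫⁻ ω, ENNReal.ofReal (∫ t in (0 : ℝ)..max (g ω - 1) 0, φ (t + 1)) ∂μ
      = ∫⁻ t in Set.Ioi (1 : ℝ), μ {ω | t < g ω} * ENNReal.ofReal (φ t) := by
  rw [lintegral_comp_eq_lintegral_meas_lt_mul μ (f := fun ω => max (g ω - 1) 0)
    (g := fun t => φ (t + 1))
    (Filter.Eventually.of_forall fun ω => le_max_right _ _)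
    ((hg.sub_const 1).max measurable_const).aemeasurable]
  · have hpre : (fun t : ℝ => t + 1) ⁻¹' Set.Ioi 1 = Set.Ioi 0 := by
      ext t; simp
    rw [← (measurePreserving_add_right volume (1 : ℝ)).setLIntegral_comp_preimage_emb
      (measurableEmbedding_addRight 1) _ (Set.Ioi 1), hpre]
    refine setLIntegral_congr_fun measurableSet_Ioi fun t ht => ?_
    have hset : {ω | t < max (g ω - 1) 0} = {ω | t + 1 < g ω} := by
      ext ω
      simp [lt_sub_iff_add_lt, not_lt.2 (le_of_lt (Set.mem_Ioi.1 ht))]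
    simp only [hset]
  · intro t ht
    refine ContinuousOn.intervalIntegrable ?_
    refine hφ.comp (by fun_prop) fun s hs => ?_
    rw [Set.uIcc_of_le ht.le] at hs
    exact Set.mem_Ioi.2 (by linarith [hs.1])
  · filter_upwards [ae_restrict_mem measurableSet_Ioi] with t ht
    exact hφ0 _ (add_pos ht one_pos)

/-- Core of Proposition 4.1 (weak-H¹ embeds into L^Φ): if `Φ` is non-decreasing, `C¹` with
`Φ(0)=0`, `Φ′(λ) ≤ c·Φ(λ)/λ`, `I = ∫_1^∞ Φ(t)/t² dt < ∞`, and `g ≥ 0` satisfies the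
weak-type bound `λ·μ({g > λ}) ≤ A`, then `∫ Φ(g) dμ ≤ μ(Ω)·Φ(1) + c·A·I`. -/
theorem stmt_8 {Ω : Type*} [MeasurableSpace Ω] (μ : Measure Ω) [IsFiniteMeasure μ]
    (Φ Φ' : ℝ → ℝ)
    (hzero : Φ 0 = 0)
    (hmono : MonotoneOn Φ (Set.Ici 0))
    (hcont : ContinuousOn Φ (Set.Ici 0))
    (hderiv : ∀ t : ℝ, 0 < t → HasDerivAt Φ (Φ' t) t)
    (hcont' : ContinuousOn Φ' (Set.Ioi 0))
    (c : ℝ) (hc : 0 < c)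
    (hbound : ∀ t : ℝ, 0 < t → Φ' t ≤ c * Φ t / t)
    (I : ℝ) (hI0 : 0 ≤ I)
    (hI : ∫⁻ t in Set.Ioi (1 : ℝ), ENNReal.ofReal (Φ t / t ^ 2) = ENNReal.ofReal I)
    (g : Ω → ℝ) (hgmeas : Measurable g) (hg0 : ∀ ω, 0 ≤ g ω)
    (A : ℝ) (hA : 0 < A)
    (hweak : ∀ l : ℝ, 0 < l → l * (μ {ω | l < g ω}).toReal ≤ A) :
    ∫⁻ ω, ENNReal.ofReal (Φ (g ω)) ∂μ
      ≤ ENNReal.ofReal ((μ Set.univ).toReal * Φ 1 + c * A * I) := by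
  have hΦ0 : ∀ t, 0 ≤ t → 0 ≤ Φ t := fun t ht => hzero ▸ hmono Set.self_mem_Ici ht ht
  have hΦ'0 : ∀ t, 0 < t → 0 ≤ Φ' t := fun t ht =>
    (hderiv t ht).nonneg_of_monotoneOn_Ici hmono ht
  have hsplit : ∀ ω, ENNReal.ofReal (Φ (g ω)) ≤ ENNReal.ofReal (Φ 1)
      + ENNReal.ofReal (∫ t in (0 : ℝ)..max (g ω - 1) 0, Φ' (t + 1)) := by
    intro ω
    rcases le_total (g ω) 1 with h | h
    · exact (ENNReal.ofReal_le_ofReal (hmono (hg0 ω) (Set.mem_Ici.2 zero_le_one) h)).trans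
        le_self_add
    · have hpos : ∀ t ∈ Set.uIcc 1 (g ω), 0 < t := fun t ht => by
        rw [Set.uIcc_of_le h] at ht
        linarith [ht.1]
      have hftc : ∫ t in (1 : ℝ)..g ω, Φ' t = Φ (g ω) - Φ 1 :=
        intervalIntegral.integral_eq_sub_of_hasDerivAt (fun t ht => hderiv t (hpos t ht))
          (hcont'.mono hpos).intervalIntegrable
      rw [max_eq_left (by linarith), intervalIntegral.integral_comp_add_right,
        zero_add, sub_add_cancel, hftc, ← ENNReal.ofReal_add (hΦ0 1 zero_le_one)
          (sub_nonneg.2 (hmono (Set.mem_Ici.2 zero_le_one) (hg0 ω) h)), add_sub_cancel]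
  have htail : ∀ t ∈ Set.Ioi (1 : ℝ), μ {ω | t < g ω} * ENNReal.ofReal (Φ' t)
      ≤ ENNReal.ofReal (c * A) * ENNReal.ofReal (Φ t / t ^ 2) := by
    intro t ht
    have ht0 : 0 < t := one_pos.trans ht
    rw [← ENNReal.ofReal_toReal (measure_ne_top μ {ω | t < g ω}),
      ← ENNReal.ofReal_mul ENNReal.toReal_nonneg, ← ENNReal.ofReal_mul (by positivity)]
    refine ENNReal.ofReal_le_ofReal ?_
    calc (μ {ω | t < g ω}).toReal * Φ' t ≤ A / t * (c * Φ t / t) :=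
          mul_le_mul ((le_div_iff₀' ht0).2 (hweak t ht0)) (hbound t ht0) (hΦ'0 t ht0)
            (by positivity)
      _ = c * A * (Φ t / t ^ 2) := by ring
  calc ∫⁻ ω, ENNReal.ofReal (Φ (g ω)) ∂μ
      ≤ ∫⁻ ω, (ENNReal.ofReal (Φ 1)
          + ENNReal.ofReal (∫ t in (0 : ℝ)..max (g ω - 1) 0, Φ' (t + 1))) ∂μ :=
        lintegral_mono hsplit
    _ = ENNReal.ofReal (Φ 1) * μ Set.univ
          + ∫⁻ t in Set.Ioi (1 : ℝ), μ {ω | t < g ω} * ENNReal.ofReal (Φ' t) := by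
        rw [lintegral_add_left measurable_const, lintegral_const,
          lintegral_integral_max_sub_one_eq μ hcont' hΦ'0 hgmeas]
    _ ≤ ENNReal.ofReal (Φ 1) * μ Set.univ
          + ENNReal.ofReal (c * A) * ENNReal.ofReal I := by
        rw [← hI, ← lintegral_const_mul' _ _ ENNReal.ofReal_ne_top]
        exact add_le_add le_rfl (setLIntegral_mono' measurableSet_Ioi htail)
    _ = ENNReal.ofReal ((μ Set.univ).toReal * Φ 1 + c * A * I) := by
        rw [ENNReal.ofReal_add (mul_nonneg ENNReal.toReal_nonneg (hΦ0 1 zero_le_one))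
          (by positivity), ENNReal.ofReal_mul ENNReal.toReal_nonneg,
          ENNReal.ofReal_toReal (measure_ne_top μ _), ENNReal.ofReal_mul (mul_pos hc hA).le,
          mul_comm (μ Set.univ)]
end

section
/- Let d ≥ 1, N ∈ ℕ, 1 < m < ∞, and let m′ = m/(m−1) be the conjugate exponent. For r > 0 set Q(r) = {(t,x) ∈ ℝ × ℝ^{d−1} : |t| + |x|² < r} with Lebesgue measure. There exists a constant C depending only on N, d and m such that for every r > 0 and every polynomial P of degree at most N in d real variables with complex coefficients, ‖P‖_{L^m(Q(r))}·‖P‖_{L^{m′}(Q(r))} ≤ C·‖P‖²_{L²(Q(r))}. -/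
open MeasureTheory

/-- The anisotropic ball `Q(r) = {(t,x) : |t| + |x|² < r}` in `ℝ^d`, the first coordinate
playing the role of `t`. -/
def Qball (d : ℕ) (hd : 1 ≤ d) (r : ℝ) : Set (Fin d → ℝ) :=
  {z | |z ⟨0, hd⟩| + ∑ i ∈ Finset.univ.erase ⟨0, hd⟩, (z i) ^ 2 < r}

/-- A finite family in `L²` which is linearly independent modulo null sets has coefficients
controlled by the `L²` norm of the linear combination. -/
lemma exists_norm_sq_le_integral_norm_sq {X ι : Type*} [Fintype ι] [MeasurableSpace X]
    (μ : Measure X) (φ : ι → X → ℂ) (hφ : ∀ i, MemLp (φ i) 2 μ)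
    (hind : ∀ c : ι → ℂ, (∀ᵐ x ∂μ, ∑ i, c i * φ i x = 0) → c = 0) :
    ∃ K : ℝ, 0 ≤ K ∧ ∀ c : ι → ℂ, ‖c‖ ^ 2 ≤ K * ∫ x, ‖∑ i, c i * φ i x‖ ^ (2 : ℝ) ∂μ := by
  let L : (ι → ℂ) →ₗ[ℂ] Lp ℂ 2 μ := Fintype.linearCombination ℂ (fun i => (hφ i).toLp (φ i))
  have hmem : ∀ c : ι → ℂ, MemLp (fun x => ∑ i, c i * φ i x) 2 μ := fun c =>
    memLp_finsetSum _ fun i _ => (hφ i).const_mul (c i)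
  have hL : ∀ c, L c =ᵐ[μ] fun x => ∑ i, c i * φ i x := by
    intro c
    have h1 : L c = ∑ i, c i • (hφ i).toLp (φ i) := by
      simp [L, Fintype.linearCombination_apply]
    rw [h1]
    refine (Lp.coeFn_finsetSum _ _).trans ?_
    have h2 : ∀ᵐ x ∂μ, ∀ i, (c i • (hφ i).toLp (φ i) : Lp ℂ 2 μ) x = c i * φ i x := by
      rw [ae_all_iff]
      intro i
      filter_upwards [Lp.coeFn_smul (c i) ((hφ i).toLp (φ i)), (hφ i).coeFn_toLp] with x hx hx'
      rw [hx, Pi.smul_apply, hx', smul_eq_mul]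
    filter_upwards [h2] with x hx
    simp [hx]
  have hinj : LinearMap.ker L = ⊥ := by
    rw [LinearMap.ker_eq_bot']
    intro c hc
    apply hind
    have h0 := Lp.coeFn_zero ℂ 2 μ
    rw [← hc] at h0
    filter_upwards [hL c, h0] with x hx hx'
    rw [← hx, hx']
    rfl
  obtain ⟨K, -, hK⟩ := L.exists_antilipschitzWith hinj
  refine ⟨(K : ℝ) ^ 2, by positivity, fun c => ?_⟩
  have h1 : ‖c‖ ≤ K * ‖L c‖ := by
    simpa using hK.le_mul_dist c 0
  have h2 : ‖L c‖ ^ 2 = ∫ x, ‖∑ i, c i * φ i x‖ ^ (2 : ℝ) ∂μ := by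
    have h3 : L c = (hmem c).toLp _ :=
      Lp.ext ((hL c).trans (hmem c).coeFn_toLp.symm)
    rw [h3, Lp.norm_toLp, (hmem c).eLpNorm_eq_integral_rpow_norm (by norm_num) (by norm_num),
      ENNReal.toReal_ofReal (by positivity), ← Real.rpow_natCast, ← Real.rpow_mul (by positivity)]
    norm_num
  calc ‖c‖ ^ 2 ≤ (K * ‖L c‖) ^ 2 := by gcongr
    _ = _ := by rw [mul_pow, h2]

/-- The product of the `L^m` and `L^{m′}` norms of a function bounded by `B`. -/
lemma integral_rpow_mul_integral_rpow_le {X : Type*} [MeasurableSpace X] {μ : Measure X}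
    {s : Set X} (hμ : μ s < ⊤) {f : X → ℂ} {B m : ℝ} (hm : 1 < m)
    (hB : 0 ≤ B) (hf : ∀ x ∈ s, ‖f x‖ ≤ B) :
    (∫ x in s, ‖f x‖ ^ m ∂μ) ^ (1 / m) * (∫ x in s, ‖f x‖ ^ (m / (m - 1)) ∂μ) ^ ((m - 1) / m) ≤
      μ.real s * B ^ 2 := by
  have key : ∀ p : ℝ, 0 < p →
      (∫ x in s, ‖f x‖ ^ p ∂μ) ^ (1 / p) ≤ B * μ.real s ^ (1 / p) := by
    intro p hp
    have h1 : ∫ x in s, ‖f x‖ ^ p ∂μ ≤ B ^ p * μ.real s := by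
      refine (Real.le_norm_self _).trans (norm_setIntegral_le_of_norm_le_const hμ fun x hx => ?_)
      rw [Real.norm_of_nonneg (by positivity)]
      exact Real.rpow_le_rpow (norm_nonneg _) (hf x hx) hp.le
    calc (∫ x in s, ‖f x‖ ^ p ∂μ) ^ (1 / p) ≤ (B ^ p * μ.real s) ^ (1 / p) :=
          Real.rpow_le_rpow (integral_nonneg fun x => by positivity) h1 (by positivity)
      _ = B * μ.real s ^ (1 / p) := by
          rw [Real.mul_rpow (by positivity) (by positivity), ← Real.rpow_mul hB,
            mul_one_div_cancel hp.ne', Real.rpow_one]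
  have hm0 : 0 < m := by linarith
  have hm1 : 0 < m - 1 := by linarith
  have hk := key (m / (m - 1)) (by positivity)
  rw [one_div_div] at hk
  calc _ ≤ (B * μ.real s ^ (1 / m)) * (B * μ.real s ^ ((m - 1) / m)) :=
        mul_le_mul (key m hm0) hk
          (Real.rpow_nonneg (integral_nonneg fun x => by positivity) _) (by positivity)
    _ = (μ.real s ^ (1 / m) * μ.real s ^ ((m - 1) / m)) * B ^ 2 := by ring
    _ = μ.real s * B ^ 2 := by
        have : 1 / m + (m - 1) / m = 1 := by field_simp; ring
        rw [← Real.rpow_add_of_nonneg (by positivity) (by positivity) (by positivity), this,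
          Real.rpow_one]

lemma isOpen_Qball (d : ℕ) (hd : 1 ≤ d) (r : ℝ) : IsOpen (Qball d hd r) :=
  isOpen_lt (by fun_prop) continuous_const

lemma abs_le_one_of_mem_Qball {d : ℕ} {hd : 1 ≤ d} {z : Fin d → ℝ} (hz : z ∈ Qball d hd 1)
    (i : Fin d) : |z i| ≤ 1 := by
  have hz' : |z ⟨0, hd⟩| + ∑ i ∈ Finset.univ.erase ⟨0, hd⟩, (z i) ^ 2 < 1 := hz
  by_cases hi : i = ⟨0, hd⟩
  · subst hi
    have : 0 ≤ ∑ i ∈ Finset.univ.erase ⟨0, hd⟩, (z i) ^ 2 :=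
      Finset.sum_nonneg fun i _ => sq_nonneg _
    linarith
  · have h1 : (z i) ^ 2 ≤ ∑ i ∈ Finset.univ.erase ⟨0, hd⟩, (z i) ^ 2 :=
      Finset.single_le_sum (f := fun i => (z i) ^ 2) (fun i _ => sq_nonneg _)
        (Finset.mem_erase.2 ⟨hi, Finset.mem_univ i⟩)
    have h2 := abs_nonneg (z ⟨0, hd⟩)
    exact (sq_le_one_iff_abs_le_one _).1 (by linarith)

lemma volume_Qball_one_lt_top (d : ℕ) (hd : 1 ≤ d) : volume (Qball d hd 1) < ⊤ := by
  have hsub : Qball d hd 1 ⊆ Metric.closedBall 0 1 := fun z hz => by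
    rw [mem_closedBall_zero_iff, pi_norm_le_iff_of_nonneg zero_le_one]
    exact abs_le_one_of_mem_Qball hz
  exact (measure_mono hsub).trans_lt measure_closedBall_lt_top

/-- The weights of the anisotropic dilation. -/
noncomputable def dilationWeight (d : ℕ) (hd : 1 ≤ d) (r : ℝ) (i : Fin d) : ℝ :=
  if i = ⟨0, hd⟩ then r else √r

lemma dilationWeight_pos {d : ℕ} {hd : 1 ≤ d} {r : ℝ} (hr : 0 < r) (i : Fin d) :
    0 < dilationWeight d hd r i := by
  unfold dilationWeight
  split_ifs <;> positivity

/-- The anisotropic dilation `(t,x) ↦ (rt, r^{1/2}x)`. -/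
noncomputable def dilation (d : ℕ) (hd : 1 ≤ d) (r : ℝ) : (Fin d → ℝ) →L[ℝ] (Fin d → ℝ) :=
  ContinuousLinearMap.pi fun i => dilationWeight d hd r i • ContinuousLinearMap.proj i

@[simp]
lemma dilation_apply (d : ℕ) (hd : 1 ≤ d) (r : ℝ) (z : Fin d → ℝ) (i : Fin d) :
    dilation d hd r z i = dilationWeight d hd r i * z i := by
  simp [dilation]

lemma dilation_mem_Qball_iff {d : ℕ} {hd : 1 ≤ d} {r : ℝ} (hr : 0 < r) (z : Fin d → ℝ) :
    dilation d hd r z ∈ Qball d hd r ↔ z ∈ Qball d hd 1 := by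
  have h1 : ∑ i ∈ Finset.univ.erase ⟨0, hd⟩, (dilation d hd r z i) ^ 2 =
      r * ∑ i ∈ Finset.univ.erase ⟨0, hd⟩, (z i) ^ 2 := by
    rw [Finset.mul_sum]
    refine Finset.sum_congr rfl fun i hi => ?_
    rw [dilation_apply, dilationWeight, if_neg (Finset.ne_of_mem_erase hi), mul_pow,
      Real.sq_sqrt hr.le]
  have h2 : |dilation d hd r z ⟨0, hd⟩| = r * |z ⟨0, hd⟩| := by
    rw [dilation_apply, dilationWeight, if_pos rfl, abs_mul, abs_of_pos hr]
  simp only [Qball, Set.mem_ofPred_eq]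
  rw [h1, h2, ← mul_add]
  exact ⟨fun h => lt_of_mul_lt_mul_left (by linarith) hr.le, fun h => by nlinarith⟩

lemma dilation_injective {d : ℕ} {hd : 1 ≤ d} {r : ℝ} (hr : 0 < r) :
    Function.Injective (dilation d hd r) := fun z w h => by
  ext i
  have := congrFun h i
  simpa [(dilationWeight_pos hr i).ne'] using this

lemma image_dilation_Qball {d : ℕ} {hd : 1 ≤ d} {r : ℝ} (hr : 0 < r) :
    dilation d hd r '' Qball d hd 1 = Qball d hd r := by
  ext z
  constructor
  · rintro ⟨w, hw, rfl⟩
    exact (dilation_mem_Qball_iff hr w).2 hw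
  · intro hz
    have hw : dilation d hd r (fun i => (dilationWeight d hd r i)⁻¹ * z i) = z := by
      ext i
      rw [dilation_apply, mul_inv_cancel_left₀ (dilationWeight_pos hr i).ne']
    exact ⟨_, (dilation_mem_Qball_iff hr _).1 (hw.symm ▸ hz), hw⟩

lemma setIntegral_Qball_eq {d : ℕ} {hd : 1 ≤ d} {r : ℝ} (hr : 0 < r) (g : (Fin d → ℝ) → ℝ) :
    ∫ z in Qball d hd r, g z =
      |(dilation d hd r).det| * ∫ z in Qball d hd 1, g (dilation d hd r z) := by
  rw [← image_dilation_Qball hr, integral_image_eq_integral_abs_det_fderiv_smul volume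
    (isOpen_Qball d hd 1).measurableSet
    (fun z _ => (dilation d hd r).hasFDerivAt.hasFDerivWithinAt)
    (dilation_injective hr).injOn]
  simp only [smul_eq_mul]
  rw [integral_const_mul]

/-- The finite set of multi-indices with all entries at most `N`. -/
noncomputable def multiIndices (d N : ℕ) : Finset (Fin d →₀ ℕ) :=
  Finset.Iic (Finsupp.equivFunOnFinite.symm fun _ => N)

lemma support_subset_multiIndices {d N : ℕ} {P : MvPolynomial (Fin d) ℂ}
    (hP : P.totalDegree ≤ N) : P.support ⊆ multiIndices d N := fun α hα => by
  rw [multiIndices, Finset.mem_Iic]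
  intro i
  exact ((MvPolynomial.monomial_le_degreeOf i hα).trans
    (MvPolynomial.degreeOf_le_totalDegree P i)).trans hP

lemma MvPolynomial.eval_eq_sum_multiIndices {d N : ℕ} {P : MvPolynomial (Fin d) ℂ}
    (hP : P.totalDegree ≤ N) (w : Fin d → ℂ) :
    MvPolynomial.eval w P = ∑ α : multiIndices d N, P.coeff α * ∏ i, w i ^ (α : Fin d →₀ ℕ) i := by
  rw [MvPolynomial.eval_eq', Finset.sum_coe_sort (multiIndices d N)
    (fun α => P.coeff α * ∏ i, w i ^ α i)]
  refine Finset.sum_subset (support_subset_multiIndices hP) fun α _ hα => ?_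
  rw [MvPolynomial.notMem_support_iff.1 hα, zero_mul]

/-- Monomials are linearly independent modulo null sets on `Q(1)`. -/
lemma eq_zero_of_ae_sum_monomials_eq_zero {d : ℕ} {hd : 1 ≤ d} {N : ℕ}
    (c : multiIndices d N → ℂ)
    (hc : ∀ᵐ z ∂(volume.restrict (Qball d hd 1)),
      ∑ α, c α * ∏ i, (z i : ℂ) ^ (α : Fin d →₀ ℕ) i = 0) : c = 0 := by
  have hzero : Set.EqOn (fun z : Fin d → ℝ => ∑ α, c α * ∏ i, (z i : ℂ) ^ (α : Fin d →₀ ℕ) i)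
      0 (Qball d hd 1) :=
    Measure.eqOn_open_of_ae_eq hc (isOpen_Qball d hd 1)
      (Continuous.continuousOn (by fun_prop)) continuousOn_const
  let P : MvPolynomial (Fin d) ℂ :=
    ∑ α : multiIndices d N, MvPolynomial.monomial (α : Fin d →₀ ℕ) (c α)
  have hPeval : ∀ w, MvPolynomial.eval w P = ∑ α, c α * ∏ i, w i ^ (α : Fin d →₀ ℕ) i := by
    intro w
    simp [P, MvPolynomial.eval_monomial, Finsupp.prod_fintype]
  have hmem : (0 : Fin d → ℝ) ∈ Qball d hd 1 := by simp [Qball]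
  obtain ⟨ε, hε, hball⟩ := Metric.isOpen_iff.1 (isOpen_Qball d hd 1) 0 hmem
  have hinf : (Complex.ofReal '' Metric.ball (0 : ℝ) ε).Infinite :=
    Set.Infinite.image Complex.ofReal_injective.injOn
      (by rw [Real.ball_eq_Ioo]; exact Set.Ioo_infinite (by linarith))
  have hP : P = 0 := by
    refine MvPolynomial.funext_set (fun _ : Fin d => Complex.ofReal '' Metric.ball (0 : ℝ) ε)
      (fun _ => hinf) fun w hw => ?_
    choose z hz hzw using fun i => hw i (Set.mem_univ i)
    obtain rfl : (fun i => (z i : ℂ)) = w := funext hzw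
    rw [hPeval, map_zero]
    refine hzero (hball ?_)
    rw [ball_pi _ hε]
    exact fun i _ => hz i
  ext α
  have h := congrArg (MvPolynomial.coeff (α : Fin d →₀ ℕ)) hP
  simpa [P, MvPolynomial.coeff_sum, MvPolynomial.coeff_monomial, Subtype.coe_inj] using h

/-- Inequality (2.14): `‖P‖_{L^m(Q(r))}·‖P‖_{L^{m′}(Q(r))} ≤ C·‖P‖²_{L²(Q(r))}` for polynomials
`P` of degree at most `N`, with `C` independent of `r` and `m′ = m/(m−1)`. -/
theorem stmt_10 (d : ℕ) (hd : 1 ≤ d) (N : ℕ) (m : ℝ) (hm1 : 1 < m) :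
    ∃ C > (0 : ℝ), ∀ r : ℝ, 0 < r → ∀ P : MvPolynomial (Fin d) ℂ, P.totalDegree ≤ N →
      (∫ z in Qball d hd r, ‖MvPolynomial.eval (fun i => (z i : ℂ)) P‖ ^ m) ^ (1 / m) *
        (∫ z in Qball d hd r,
            ‖MvPolynomial.eval (fun i => (z i : ℂ)) P‖ ^ (m / (m - 1))) ^ ((m - 1) / m)
      ≤ C * ∫ z in Qball d hd r, ‖MvPolynomial.eval (fun i => (z i : ℂ)) P‖ ^ (2 : ℝ) := by
  have hm0 : 0 < m := by linarith
  have hm0' : 0 < m - 1 := by linarith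
  have hmeas := (isOpen_Qball d hd 1).measurableSet
  have hvol := volume_Qball_one_lt_top d hd
  let φ : multiIndices d N → (Fin d → ℝ) → ℂ := fun α z => ∏ i, (z i : ℂ) ^ (α : Fin d →₀ ℕ) i
  have hφ1 : ∀ α, ∀ z ∈ Qball d hd 1, ‖φ α z‖ ≤ 1 := fun α z hz => by
    simp only [φ, norm_prod, norm_pow, Complex.norm_real, Real.norm_eq_abs]
    exact Finset.prod_le_one (fun i _ => by positivity)
      fun i _ => pow_le_one₀ (abs_nonneg _) (abs_le_one_of_mem_Qball hz i)
  have : IsFiniteMeasure (volume.restrict (Qball d hd 1)) := ⟨by simpa using hvol⟩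
  have hφ : ∀ α, MemLp (φ α) 2 (volume.restrict (Qball d hd 1)) := fun α =>
    MemLp.of_bound (Continuous.aestronglyMeasurable (by fun_prop)) 1
      ((ae_restrict_iff' hmeas).2 (.of_forall (hφ1 α)))
  obtain ⟨K, hK0, hK⟩ := exists_norm_sq_le_integral_norm_sq _ φ hφ
    (fun c hc => eq_zero_of_ae_sum_monomials_eq_zero c hc)
  set V := volume.real (Qball d hd 1)
  set n : ℝ := (Fintype.card (multiIndices d N) : ℝ)
  refine ⟨V * n ^ 2 * K + 1, by positivity, fun r hr P hP => ?_⟩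
  let c : multiIndices d N → ℂ := fun α =>
    P.coeff α * ∏ i, (dilationWeight d hd r i : ℂ) ^ (α : Fin d →₀ ℕ) i
  have hc : ∀ z : Fin d → ℝ,
      MvPolynomial.eval (fun i => (dilation d hd r z i : ℂ)) P = ∑ α, c α * φ α z := by
    intro z
    rw [MvPolynomial.eval_eq_sum_multiIndices hP]
    refine Finset.sum_congr rfl fun α _ => ?_
    simp only [c, φ, dilation_apply, Complex.ofReal_mul, mul_pow, Finset.prod_mul_distrib,
      mul_assoc]
  have hbound : ∀ z ∈ Qball d hd 1, ‖∑ α, c α * φ α z‖ ≤ n * ‖c‖ := fun z hz => by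
    calc ‖∑ α, c α * φ α z‖ ≤ ∑ α : multiIndices d N, ‖c‖ := by
          refine norm_sum_le_of_le _ fun α _ => ?_
          rw [norm_mul]
          exact (mul_le_of_le_one_right (norm_nonneg _) (hφ1 α z hz)).trans (norm_le_pi_norm c α)
      _ = n * ‖c‖ := by simp [n]
  have hmain := integral_rpow_mul_integral_rpow_le hvol hm1 (by positivity) hbound
  rw [setIntegral_Qball_eq hr, setIntegral_Qball_eq hr, setIntegral_Qball_eq hr]
  simp only [hc]
  set D := |(dilation d hd r).det|
  have hD : 0 ≤ D := abs_nonneg _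
  have hDD : D ^ (1 / m) * D ^ ((m - 1) / m) = D := by
    have : 1 / m + (m - 1) / m = 1 := by field_simp; ring
    rw [← Real.rpow_add_of_nonneg hD (by positivity) (by positivity), this, Real.rpow_one]
  have hI : ∀ p : ℝ, 0 ≤ ∫ z in Qball d hd 1, ‖∑ α, c α * φ α z‖ ^ p := fun p =>
    integral_nonneg fun z => by positivity
  rw [Real.mul_rpow hD (hI _), Real.mul_rpow hD (hI _), mul_mul_mul_comm, hDD,
    mul_left_comm (V * n ^ 2 * K + 1)]
  refine mul_le_mul_of_nonneg_left (hmain.trans ?_) hD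
  calc V * (n * ‖c‖) ^ 2 = V * n ^ 2 * ‖c‖ ^ 2 := by ring
    _ ≤ V * n ^ 2 * (K * ∫ z in Qball d hd 1, ‖∑ α, c α * φ α z‖ ^ (2 : ℝ)) := by
        gcongr
        exact hK c
    _ ≤ _ := by
        have := hI 2
        linarith
end

section
/- Let 0 < p ≤ 1 and let Φ be a growth function in the class 𝓛_p, with lower-type constant C (that is, Φ(st) ≤ C·t^p·Φ(s) for all s > 0 and 0 < t ≤ 1, and t ↦ Φ(t)/t is non-increasing on (0,∞)). Then the function Φ̃(t) := ∫_0^t Φ(s)/s ds is finite for every t ≥ 0, is concave on [0,∞), is differentiable on (0,∞) with Φ̃′(t) = Φ(t)/t, and satisfies Φ(t) ≤ Φ̃(t) ≤ (C/p)·Φ(t) for all t > 0. -/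
open MeasureTheory

/-- For `Φ ∈ 𝓛_p` with lower-type constant `C`, the equivalent growth function
`Φ̃(t) = ∫_0^t Φ(s)/s ds` is finite, concave, differentiable with `Φ̃′(t) = Φ(t)/t`, and
satisfies `Φ(t) ≤ Φ̃(t) ≤ (C/p)·Φ(t)`. -/
theorem stmt_13 (p : ℝ) (hp0 : 0 < p) (hp1 : p ≤ 1)
    (Φ : ℝ → ℝ)
    (hcont : ContinuousOn Φ (Set.Ici 0))
    (hmono : MonotoneOn Φ (Set.Ici 0))
    (hmaps : Set.MapsTo Φ (Set.Ici 0) (Set.Ici 0))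
    (hsurj : Set.SurjOn Φ (Set.Ici 0) (Set.Ici 0))
    (C : ℝ) (hC : 0 < C)
    (hlow : ∀ s > 0, ∀ t : ℝ, 0 < t → t ≤ 1 → Φ (s * t) ≤ C * t ^ p * Φ s)
    (hratio : ∀ s t : ℝ, 0 < s → s ≤ t → Φ t / t ≤ Φ s / s) :
    (∀ t : ℝ, 0 ≤ t → IntegrableOn (fun s => Φ s / s) (Set.Ioc 0 t)) ∧
    ConcaveOn ℝ (Set.Ici 0) (fun t => ∫ s in Set.Ioc (0 : ℝ) t, Φ s / s) ∧
    (∀ t : ℝ, 0 < t →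
      HasDerivAt (fun t => ∫ s in Set.Ioc (0 : ℝ) t, Φ s / s) (Φ t / t) t) ∧
    (∀ t : ℝ, 0 < t →
      Φ t ≤ (∫ s in Set.Ioc (0 : ℝ) t, Φ s / s) ∧
      (∫ s in Set.Ioc (0 : ℝ) t, Φ s / s) ≤ (C / p) * Φ t) := by
  set g : ℝ → ℝ := fun s => Φ s / s with hg
  have hgcont : ContinuousOn g (Set.Ioi 0) :=
    (hcont.mono Set.Ioi_subset_Ici_self).div continuousOn_id fun x hx => ne_of_gt hx
  have hbound : ∀ t : ℝ, 0 < t → ∀ s ∈ Set.Ioc 0 t,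
      g s ≤ C * Φ t * (t ^ p)⁻¹ * s ^ (p - 1) := by
    intro t ht s hs
    have h := hlow t ht (s / t) (div_pos hs.1 ht) ((div_le_one ht).2 hs.2)
    rw [mul_div_cancel₀ _ ht.ne', Real.div_rpow hs.1.le ht.le] at h
    rw [Real.rpow_sub_one hs.1.ne']
    calc g s ≤ (C * (s ^ p / t ^ p) * Φ t) / s := div_le_div_of_nonneg_right h hs.1.le
      _ = _ := by ring
  have hdom : ∀ t : ℝ, 0 < t →
      IntegrableOn (fun s => C * Φ t * (t ^ p)⁻¹ * s ^ (p - 1)) (Set.Ioc 0 t) := by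
    intro t ht
    refine Integrable.const_mul ?_ _
    exact (intervalIntegrable_iff_integrableOn_Ioc_of_le ht.le).1
      (intervalIntegral.intervalIntegrable_rpow' (by linarith))
  have hint : ∀ t : ℝ, 0 ≤ t → IntegrableOn g (Set.Ioc 0 t) := by
    intro t ht
    rcases ht.eq_or_lt with rfl | ht
    · simp
    refine Integrable.mono' (hdom t ht)
      ((hgcont.mono Set.Ioc_subset_Ioi_self).aestronglyMeasurable measurableSet_Ioc) ?_
    filter_upwards [ae_restrict_mem measurableSet_Ioc] with s hs
    rw [Real.norm_of_nonneg (div_nonneg (hmaps hs.1.le) hs.1.le)]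
    exact hbound t ht s hs
  have hderiv : ∀ t : ℝ, 0 < t →
      HasDerivAt (fun t => ∫ s in Set.Ioc (0 : ℝ) t, g s) (g t) t := by
    intro t ht
    have h := intervalIntegral.integral_hasDerivAt_right
      ((intervalIntegrable_iff_integrableOn_Ioc_of_le ht.le).2 (hint t ht.le))
      (hgcont.stronglyMeasurableAtFilter isOpen_Ioi t ht)
      (hgcont.continuousAt (Ioi_mem_nhds ht))
    refine h.congr_of_eventuallyEq ?_
    filter_upwards [Ioi_mem_nhds ht] with u hu
    exact (intervalIntegral.integral_of_le (le_of_lt hu)).symm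
  refine ⟨hint, ?_, hderiv, fun t ht => ⟨?_, ?_⟩⟩
  · refine AntitoneOn.concaveOn_of_deriv (convex_Ici 0) ?_ ?_ ?_
    · intro t ht
      rcases (Set.mem_Ici.1 ht).eq_or_lt with rfl | ht
      · have h := intervalIntegral.continuousOn_primitive
          ((integrableOn_Icc_iff_integrableOn_Ioc).2 (hint 1 zero_le_one))
        exact (h 0 (by simp)).mono_of_mem_nhdsWithin (Icc_mem_nhdsGE zero_lt_one)
      · exact (hderiv t ht).continuousAt.continuousWithinAt
    · rw [interior_Ici]
      exact fun t ht => (hderiv t ht).differentiableAt.differentiableWithinAt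
    · rw [interior_Ici]
      intro s hs t ht hst
      rw [(hderiv s hs).deriv, (hderiv t ht).deriv]
      exact hratio s t hs hst
  · calc Φ t = ∫ _ in Set.Ioc (0 : ℝ) t, g t := by
          simp [hg, ht.le, mul_div_cancel₀ _ ht.ne']
      _ ≤ _ := setIntegral_mono_on (by simp) (hint t ht.le) measurableSet_Ioc
          fun s hs => hratio s t hs.1 hs.2
  · calc ∫ s in Set.Ioc (0 : ℝ) t, g s
        ≤ ∫ s in Set.Ioc (0 : ℝ) t, C * Φ t * (t ^ p)⁻¹ * s ^ (p - 1) :=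
          setIntegral_mono_on (hint t ht.le) (hdom t ht) measurableSet_Ioc (hbound t ht)
      _ = C * Φ t * (t ^ p)⁻¹ * (t ^ p / p) := by
          rw [integral_const_mul, ← intervalIntegral.integral_of_le ht.le,
            integral_rpow (Or.inl (by linarith)), sub_add_cancel, Real.zero_rpow hp0.ne', sub_zero]
      _ = C / p * Φ t := by
          have := (Real.rpow_pos_of_pos ht p).ne'
          field_simp
end

section
/- Let q ≥ 1 and let Φ be a growth function in the class 𝓤^q, with upper-type constant C (that is, Φ(st) ≤ C·t^q·Φ(s) for all s > 0 and t ≥ 1, and t ↦ Φ(t)/t is non-decreasing on (0,∞)). Then the function Φ̃(t) := ∫_0^t Φ(s)/s ds is convex on [0,∞), is differentiable on (0,∞) with Φ̃′(t) = Φ(t)/t, and satisfies Φ(t)/(2^{q+1}·C) ≤ Φ̃(t) ≤ Φ(t) for all t > 0. -/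
open MeasureTheory

/-- The primitive of a function that is monotone on `[0, ∞)` is continuous there. -/
theorem MonotoneOn.continuousOn_setIntegral_Ioc {g : ℝ → ℝ} (hg : MonotoneOn g (Set.Ici 0)) :
    ContinuousOn (fun t => ∫ s in Set.Ioc (0 : ℝ) t, g s) (Set.Ici 0) := by
  have hmono : Monotone fun s => g (max s 0) := fun a b hab =>
    hg (le_max_right a 0) (le_max_right b 0) (max_le_max_right 0 hab)
  have hprim : Continuous fun t => ∫ s in (0 : ℝ)..t, g (max s 0) :=
    intervalIntegral.continuous_primitive (fun _ _ => hmono.intervalIntegrable) 0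
  refine hprim.continuousOn.congr fun t ht => ?_
  simp only [intervalIntegral.integral_of_le (Set.mem_Ici.1 ht)]
  refine setIntegral_congr_fun measurableSet_Ioc fun s hs => ?_
  simp only [max_eq_left hs.1.le]

/-- The primitive of a function that is monotone on `[0, ∞)` is differentiable at every positive
point of continuity. -/
theorem MonotoneOn.hasDerivAt_setIntegral_Ioc {g : ℝ → ℝ} (hg : MonotoneOn g (Set.Ici 0))
    {t : ℝ} (ht : 0 < t) (hcont : ContinuousAt g t) :
    HasDerivAt (fun t => ∫ s in Set.Ioc (0 : ℝ) t, g s) (g t) t := by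
  have hmono : MonotoneOn g (Set.Icc 0 (t + 1)) := hg.mono Set.Icc_subset_Ici_self
  have hmeas : StronglyMeasurableAtFilter g (nhds t) :=
    ⟨Set.Icc 0 (t + 1), Icc_mem_nhds ht (lt_add_one t),
      (hmono.integrableOn_isCompact isCompact_Icc).aestronglyMeasurable⟩
  have hint : IntervalIntegrable g volume 0 t := by
    refine MonotoneOn.intervalIntegrable (hg.mono ?_)
    rw [Set.uIcc_of_le ht.le]
    exact Set.Icc_subset_Ici_self
  refine (intervalIntegral.integral_hasDerivAt_right hint hmeas hcont).congr_of_eventuallyEq ?_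
  filter_upwards [Ioi_mem_nhds ht] with x hx
  exact (intervalIntegral.integral_of_le (le_of_lt hx)).symm

/-- For `Φ ∈ 𝓤^q` with upper-type constant `C`, the equivalent growth function
`Φ̃(t) = ∫_0^t Φ(s)/s ds` is convex, differentiable with `Φ̃′(t) = Φ(t)/t`, and satisfies
`Φ(t)/(2^{q+1}·C) ≤ Φ̃(t) ≤ Φ(t)`. -/
theorem stmt_14 (q : ℝ) (hq : 1 ≤ q)
    (Φ : ℝ → ℝ)
    (hcont : ContinuousOn Φ (Set.Ici 0))
    (hmono : MonotoneOn Φ (Set.Ici 0))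
    (hmaps : Set.MapsTo Φ (Set.Ici 0) (Set.Ici 0))
    (hsurj : Set.SurjOn Φ (Set.Ici 0) (Set.Ici 0))
    (C : ℝ) (hC : 0 < C)
    (hup : ∀ s > 0, ∀ t : ℝ, 1 ≤ t → Φ (s * t) ≤ C * t ^ q * Φ s)
    (hratio : ∀ s t : ℝ, 0 < s → s ≤ t → Φ s / s ≤ Φ t / t) :
    (∀ t : ℝ, 0 ≤ t → IntegrableOn (fun s => Φ s / s) (Set.Ioc 0 t)) ∧
    ConvexOn ℝ (Set.Ici 0) (fun t => ∫ s in Set.Ioc (0 : ℝ) t, Φ s / s) ∧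
    (∀ t : ℝ, 0 < t →
      HasDerivAt (fun t => ∫ s in Set.Ioc (0 : ℝ) t, Φ s / s) (Φ t / t) t) ∧
    (∀ t : ℝ, 0 < t →
      Φ t / ((2 : ℝ) ^ (q + 1) * C) ≤ (∫ s in Set.Ioc (0 : ℝ) t, Φ s / s) ∧
      (∫ s in Set.Ioc (0 : ℝ) t, Φ s / s) ≤ Φ t) := by
  have hg : MonotoneOn (fun s => Φ s / s) (Set.Ici 0) := by
    intro a ha b hb hab
    rcases eq_or_lt_of_le (Set.mem_Ici.1 ha) with rfl | ha'
    · simpa using div_nonneg (hmaps hb) hb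
    · exact hratio a b ha' hab
  have hint : ∀ t : ℝ, 0 ≤ t → IntegrableOn (fun s => Φ s / s) (Set.Ioc 0 t) := fun t _ =>
    ((hg.mono Set.Icc_subset_Ici_self).integrableOn_isCompact isCompact_Icc).mono_set
      Set.Ioc_subset_Icc_self
  have hderiv : ∀ t : ℝ, 0 < t →
      HasDerivAt (fun t => ∫ s in Set.Ioc (0 : ℝ) t, Φ s / s) (Φ t / t) t := fun t ht =>
    hg.hasDerivAt_setIntegral_Ioc ht
      ((hcont.continuousAt (Ici_mem_nhds ht)).div continuousAt_id ht.ne')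
  refine ⟨hint, ?_, hderiv, fun t ht => ⟨?_, ?_⟩⟩
  · refine MonotoneOn.convexOn_of_deriv (convex_Ici 0) hg.continuousOn_setIntegral_Ioc ?_ ?_
    · rw [interior_Ici]
      exact fun t ht => (hderiv t ht).differentiableAt.differentiableWithinAt
    · rw [interior_Ici]
      intro a ha b hb hab
      rw [(hderiv a ha).deriv, (hderiv b hb).deriv]
      exact hratio a b ha hab
  · have ht2 : 0 < t / 2 := half_pos ht
    have hpos : 0 ≤ Φ (t / 2) := hmaps ht2.le
    have hdouble : Φ t ≤ C * 2 ^ q * Φ (t / 2) := by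
      simpa using hup (t / 2) ht2 2 one_le_two
    have hsub : Set.Ioc (t / 2) t ⊆ Set.Ioc 0 t := Set.Ioc_subset_Ioc_left ht2.le
    calc Φ t / ((2 : ℝ) ^ (q + 1) * C) ≤ Φ (t / 2) := by
          rw [div_le_iff₀ (by positivity), Real.rpow_add_one two_ne_zero]
          have : 0 ≤ C * 2 ^ q * Φ (t / 2) := by positivity
          linarith
      _ = ∫ _ in Set.Ioc (t / 2) t, Φ (t / 2) / (t / 2) := by
          rw [setIntegral_const, Real.volume_real_Ioc_of_le (by linarith), smul_eq_mul]
          field_simp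
          ring
      _ ≤ ∫ s in Set.Ioc (t / 2) t, Φ s / s :=
          setIntegral_mono_on (integrableOn_const (by simp)) ((hint t ht.le).mono_set hsub)
            measurableSet_Ioc fun s hs => hratio _ _ ht2 hs.1.le
      _ ≤ ∫ s in Set.Ioc (0 : ℝ) t, Φ s / s := by
          refine setIntegral_mono_set (hint t ht.le) ?_ hsub.eventuallyLE
          filter_upwards [ae_restrict_mem measurableSet_Ioc] with s hs
          exact div_nonneg (hmaps hs.1.le) hs.1.le
  · calc (∫ s in Set.Ioc (0 : ℝ) t, Φ s / s) ≤ ∫ _ in Set.Ioc (0 : ℝ) t, Φ t / t :=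
          setIntegral_mono_on (hint t ht.le) (integrableOn_const (by simp)) measurableSet_Ioc
            fun s hs => hratio s t hs.1 hs.2
      _ = Φ t := by
          rw [setIntegral_const, Real.volume_real_Ioc_of_le ht.le, smul_eq_mul]
          field_simp
          simp
end

section
/- Let Φ₁, Φ₂ and Φ be increasing homeomorphisms of [0,∞) onto itself such that Φ⁻¹(t) = Φ₁⁻¹(t)·Φ₂⁻¹(t) for all t ≥ 0. Then for all u, v ≥ 0, Φ(u·v) ≤ Φ₁(u) + Φ₂(v). -/
/-- Pointwise Young-type inequality: if `Φ⁻¹ = Φ₁⁻¹·Φ₂⁻¹` for increasing homeomorphisms of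
`[0,∞)`, then `Φ(u·v) ≤ Φ₁(u) + Φ₂(v)` for all `u, v ≥ 0`. -/
theorem stmt_16 (Φ Φinv Φ₁ Φ₁inv Φ₂ Φ₂inv : ℝ → ℝ)
    (hmono : StrictMonoOn Φ (Set.Ici 0))
    (hcont : ContinuousOn Φ (Set.Ici 0))
    (hzero : Φ 0 = 0)
    (hinv_nonneg : ∀ t, 0 ≤ t → 0 ≤ Φinv t)
    (hleft : ∀ t, 0 ≤ t → Φinv (Φ t) = t)
    (hright : ∀ t, 0 ≤ t → Φ (Φinv t) = t)
    (h₁mono : StrictMonoOn Φ₁ (Set.Ici 0))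
    (h₁cont : ContinuousOn Φ₁ (Set.Ici 0))
    (h₁zero : Φ₁ 0 = 0)
    (h₁inv_nonneg : ∀ t, 0 ≤ t → 0 ≤ Φ₁inv t)
    (h₁left : ∀ t, 0 ≤ t → Φ₁inv (Φ₁ t) = t)
    (h₁right : ∀ t, 0 ≤ t → Φ₁ (Φ₁inv t) = t)
    (h₂mono : StrictMonoOn Φ₂ (Set.Ici 0))
    (h₂cont : ContinuousOn Φ₂ (Set.Ici 0))
    (h₂zero : Φ₂ 0 = 0)
    (h₂inv_nonneg : ∀ t, 0 ≤ t → 0 ≤ Φ₂inv t)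
    (h₂left : ∀ t, 0 ≤ t → Φ₂inv (Φ₂ t) = t)
    (h₂right : ∀ t, 0 ≤ t → Φ₂ (Φ₂inv t) = t)
    -- `Φ⁻¹ = Φ₁⁻¹ · Φ₂⁻¹` :
    (hdef : ∀ t, 0 ≤ t → Φinv t = Φ₁inv t * Φ₂inv t) :
    ∀ u v : ℝ, 0 ≤ u → 0 ≤ v → Φ (u * v) ≤ Φ₁ u + Φ₂ v := by
  intro u v hu hv
  have hΦ₁u : 0 ≤ Φ₁ u := h₁zero ▸ h₁mono.monotoneOn Set.self_mem_Ici hu hu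
  have hΦ₂v : 0 ≤ Φ₂ v := h₂zero ▸ h₂mono.monotoneOn Set.self_mem_Ici hv hv
  set t := Φ₁ u + Φ₂ v with ht_def
  have ht : 0 ≤ t := add_nonneg hΦ₁u hΦ₂v
  have hu_le : u ≤ Φ₁inv t :=
    (h₁mono.le_iff_le hu (h₁inv_nonneg t ht)).1 (by rw [h₁right t ht]; linarith)
  have hv_le : v ≤ Φ₂inv t :=
    (h₂mono.le_iff_le hv (h₂inv_nonneg t ht)).1 (by rw [h₂right t ht]; linarith)
  have huv : u * v ≤ Φinv t := by
    rw [hdef t ht]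
    exact mul_le_mul hu_le hv_le hv (h₁inv_nonneg t ht)
  calc Φ (u * v) ≤ Φ (Φinv t) :=
        hmono.monotoneOn (mul_nonneg hu hv) (hinv_nonneg t ht) huv
    _ = t := hright t ht
end

section
/- Let Φ be a growth function such that t ↦ Φ(t)/t is non-decreasing on (0,∞), and suppose Φ satisfies the Dini condition: there is C > 0 with ∫_0^t Φ(s)/s² ds ≤ C·Φ(t)/t for all t > 0. Then for every l > 1 with log l ≥ 2C one has Φ(lt) ≥ 2l·Φ(t) for all t ≥ 0, and consequently the complementary function Ψ(s) = sup_{t ≥ 0}(ts − Φ(t)) satisfies Ψ(2s) ≤ 2l·Ψ(s) for all s ≥ 0; in particular Ψ satisfies the Δ₂-condition. -/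
open MeasureTheory

/-- If `Φ t / t` is non-decreasing, then the integral of `Φ s / s ^ 2` over `(t, l * t]` is at
least `Φ t / t * log l`. -/
lemma ofReal_ratio_mul_log_le_lintegral {Φ : ℝ → ℝ}
    (hratio : ∀ s t : ℝ, 0 < s → s ≤ t → Φ s / s ≤ Φ t / t)
    {l t : ℝ} (hl : 1 < l) (ht : 0 < t) (hΦ : 0 ≤ Φ t) :
    ENNReal.ofReal (Φ t / t * Real.log l)
      ≤ ∫⁻ s in Set.Ioc t (l * t), ENNReal.ofReal (Φ s / s ^ 2) := by
  have hlt : t ≤ l * t := by nlinarith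
  have hint : IntervalIntegrable (fun s : ℝ => Φ t / t * s⁻¹) volume t (l * t) := by
    refine ContinuousOn.intervalIntegrable_of_Icc hlt ?_
    exact continuousOn_const.mul
      (continuousOn_id.inv₀ fun s hs => (ht.trans_le hs.1).ne')
  have hval : ∫ s in Set.Ioc t (l * t), Φ t / t * s⁻¹ = Φ t / t * Real.log l := by
    rw [← intervalIntegral.integral_of_le hlt, intervalIntegral.integral_const_mul,
      integral_inv_of_pos ht (ht.trans_le hlt), mul_div_cancel_right₀ _ ht.ne']
  rw [← hval, ofReal_integral_eq_lintegral_ofReal]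
  · refine setLIntegral_mono' measurableSet_Ioc fun s hs => ENNReal.ofReal_le_ofReal ?_
    have hs0 : 0 < s := ht.trans hs.1
    calc Φ t / t * s⁻¹ ≤ Φ s / s * s⁻¹ :=
          mul_le_mul_of_nonneg_right (hratio t s ht hs.1.le) (inv_nonneg.2 hs0.le)
      _ = Φ s / s ^ 2 := by field_simp
  · exact (intervalIntegrable_iff_integrableOn_Ioc_of_le hlt).1 hint
  · refine (ae_restrict_iff' measurableSet_Ioc).2 (Filter.Eventually.of_forall fun s hs => ?_)
    have hs0 : 0 < s := ht.trans hs.1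
    change 0 ≤ Φ t / t * s⁻¹
    positivity

/-- The Dini condition forces `Φ` to grow by the factor `2 * l` under dilation by `l`. -/
lemma two_mul_le_of_dini {Φ : ℝ → ℝ} (hmaps : Set.MapsTo Φ (Set.Ici 0) (Set.Ici 0))
    (hratio : ∀ s t : ℝ, 0 < s → s ≤ t → Φ s / s ≤ Φ t / t)
    {C : ℝ} (hC : 0 < C)
    (hdini : ∀ t : ℝ, 0 < t →
      ∫⁻ s in Set.Ioc (0 : ℝ) t, ENNReal.ofReal (Φ s / s ^ 2)
        ≤ ENNReal.ofReal (C * Φ t / t))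
    {l t : ℝ} (hl : 1 < l) (hlog : 2 * C ≤ Real.log l) (ht : 0 < t) :
    2 * l * Φ t ≤ Φ (l * t) := by
  have hl0 : 0 < l := one_pos.trans hl
  have hlt : 0 < l * t := mul_pos hl0 ht
  have hΦt : 0 ≤ Φ t := hmaps ht.le
  have hΦlt : 0 ≤ Φ (l * t) := hmaps hlt.le
  have h := (ofReal_ratio_mul_log_le_lintegral hratio hl ht hΦt).trans
    ((lintegral_mono_set (Set.Ioc_subset_Ioc_left ht.le)).trans (hdini (l * t) hlt))
  rw [ENNReal.ofReal_le_ofReal_iff (by positivity)] at h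
  have h' : Φ t / t * (2 * C) ≤ C * Φ (l * t) / (l * t) :=
    (mul_le_mul_of_nonneg_left hlog (by positivity)).trans h
  rw [le_div_iff₀ hlt] at h'
  have h'' : Φ t / t * (2 * C) * (l * t) = C * (2 * l * Φ t) := by field_simp
  rw [h''] at h'
  exact le_of_mul_le_mul_left h' hC

/-- A dilation lower bound for `Φ` gives a doubling bound for its complementary function. If the
supremum at `s` is infinite then so is the one at `2 * s`, and both sides are zero. -/
lemma sSup_complementary_two_mul_le {Φ : ℝ → ℝ} {l : ℝ} (hl : 0 < l)
    (hΦ : ∀ t : ℝ, 0 ≤ t → 2 * l * Φ t ≤ Φ (l * t)) {s : ℝ} (hs : 0 ≤ s) :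
    sSup ((fun t => t * (2 * s) - Φ t) '' Set.Ici 0)
      ≤ 2 * l * sSup ((fun t => t * s - Φ t) '' Set.Ici 0) := by
  by_cases hb : BddAbove ((fun t => t * s - Φ t) '' Set.Ici 0)
  · refine csSup_le (Set.nonempty_Ici.image _) ?_
    rintro _ ⟨t, ht, rfl⟩
    have hu : 0 ≤ t / l := div_nonneg ht hl.le
    have hle := mul_le_mul_of_nonneg_left (le_csSup hb ⟨t / l, hu, rfl⟩)
      (by positivity : 0 ≤ 2 * l)
    have hg := hΦ (t / l) hu
    rw [mul_div_cancel₀ t hl.ne'] at hg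
    have he : 2 * l * (t / l * s - Φ (t / l)) = t * (2 * s) - 2 * l * Φ (t / l) := by
      field_simp
    refine le_trans ?_ hle
    change _ ≤ 2 * l * (t / l * s - Φ (t / l))
    rw [he]
    exact sub_le_sub_left hg _
  · have hb' : ¬ BddAbove ((fun t => t * (2 * s) - Φ t) '' Set.Ici 0) := by
      rintro ⟨M, hM⟩
      refine hb ⟨M, ?_⟩
      rintro _ ⟨t, ht, rfl⟩
      have := hM ⟨t, ht, rfl⟩
      have hts : 0 ≤ t * s := mul_nonneg ht hs
      dsimp only at this ⊢
      linarith
    rw [Real.sSup_of_not_bddAbove hb, Real.sSup_of_not_bddAbove hb', mul_zero]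

/-- If `Φ` is a growth function with `t ↦ Φ(t)/t` non-decreasing satisfying the Dini condition
`∫_0^t Φ(s)/s² ds ≤ C·Φ(t)/t`, then for every `l > 1` with `log l ≥ 2C` one has
`Φ(lt) ≥ 2l·Φ(t)` and hence `Ψ(2s) ≤ 2l·Ψ(s)` for the complementary function `Ψ`; in
particular `Ψ` satisfies the `Δ₂`-condition. -/
theorem stmt_17 (Φ : ℝ → ℝ)
    (hcont : ContinuousOn Φ (Set.Ici 0))
    (hmono : MonotoneOn Φ (Set.Ici 0))
    (hmaps : Set.MapsTo Φ (Set.Ici 0) (Set.Ici 0))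
    (hsurj : Set.SurjOn Φ (Set.Ici 0) (Set.Ici 0))
    (hratio : ∀ s t : ℝ, 0 < s → s ≤ t → Φ s / s ≤ Φ t / t)
    (C : ℝ) (hC : 0 < C)
    (hdini : ∀ t : ℝ, 0 < t →
      ∫⁻ s in Set.Ioc (0 : ℝ) t, ENNReal.ofReal (Φ s / s ^ 2)
        ≤ ENNReal.ofReal (C * Φ t / t))
    (Ψ : ℝ → ℝ)
    (hΨ : ∀ s, Ψ s = sSup ((fun t => t * s - Φ t) '' Set.Ici 0)) :
    (∀ l : ℝ, 1 < l → 2 * C ≤ Real.log l →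
      (∀ t : ℝ, 0 ≤ t → 2 * l * Φ t ≤ Φ (l * t)) ∧
      (∀ s : ℝ, 0 ≤ s → Ψ (2 * s) ≤ 2 * l * Ψ s)) ∧
    (∃ K > (1 : ℝ), ∀ s : ℝ, 0 ≤ s → Ψ (2 * s) ≤ K * Ψ s) := by
  have hzero : Φ 0 = 0 := by
    obtain ⟨t, ht, h⟩ := hsurj (Set.self_mem_Ici (a := (0 : ℝ)))
    exact le_antisymm (h ▸ hmono Set.self_mem_Ici ht ht) (hmaps Set.self_mem_Ici)
  have key : ∀ l : ℝ, 1 < l → 2 * C ≤ Real.log l →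
      (∀ t : ℝ, 0 ≤ t → 2 * l * Φ t ≤ Φ (l * t)) ∧
      (∀ s : ℝ, 0 ≤ s → Ψ (2 * s) ≤ 2 * l * Ψ s) := by
    intro l hl hlog
    have hgrow : ∀ t : ℝ, 0 ≤ t → 2 * l * Φ t ≤ Φ (l * t) := by
      intro t ht
      rcases ht.eq_or_lt with rfl | ht
      · simp [hzero]
      · exact two_mul_le_of_dini hmaps hratio hC hdini hl hlog ht
    refine ⟨hgrow, fun s hs => ?_⟩
    rw [hΨ, hΨ]
    exact sSup_complementary_two_mul_le (one_pos.trans hl) hgrow hs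
  have hexp : 1 < Real.exp (2 * C) := Real.one_lt_exp_iff.2 (by positivity)
  exact ⟨key, 2 * Real.exp (2 * C), by linarith,
    (key _ hexp (Real.log_exp _).ge).2⟩
end
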